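/- The density f is the unique independence-preserving density for Ψ: if g is a continuous, strictly positive probability density on (1,∞) such that the pushforward of the product measure (g da)⊗(g db)⊗(g dc) on (1,∞)³ under Ψ is again a product measure of the form (h dA)⊗(h dB)⊗(h dC) for some function h on (1,∞), then g(u) = f(u) = 2^{1/3} C u^{−2/3}(u² − 1)^{−1/3} for all u > 1, where C = √3 Γ(2/3) Γ(5/6)/(2π^{3/2}). -/

import Mathlib

open MeasureTheory

/-- The ratio `R_A = (1+abc)(a+bc)/((b+ac)(c+ab))`. -/
noncomputable def ratioA (a b c : ℝ) : ℝ :=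
  (1 + a*b*c) * (a + b*c) / ((b + a*c) * (c + a*b))

/-- The unique `A > 1` with `(A+1)/(A−1) = √R_A`, namely `A = (√R_A + 1)/(√R_A − 1)`. -/
noncomputable def hexA (a b c : ℝ) : ℝ :=
  (Real.sqrt (ratioA a b c) + 1) / (Real.sqrt (ratioA a b c) - 1)

/-- `Ψ` on ordered triples: `Ψ(a,b,c) = (A,B,C)`. -/
noncomputable def Psi (p : ℝ × ℝ × ℝ) : ℝ × ℝ × ℝ :=
  (hexA p.1 p.2.1 p.2.2, hexA p.2.1 p.1 p.2.2, hexA p.2.2 p.1 p.2.1)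

/-- The normalizing constant `C = √3 Γ(2/3) Γ(5/6) / (2 π^{3/2})`. -/
noncomputable def hexConst : ℝ :=
  Real.sqrt 3 * Real.Gamma (2/3) * Real.Gamma (5/6) / (2 * Real.pi ^ ((3:ℝ)/2))

/-- The density `f(u) = 2^{1/3} C u^{−2/3}(u²−1)^{−1/3}`. -/
noncomputable def fdens (u : ℝ) : ℝ :=
  (2:ℝ) ^ ((1:ℝ)/3) * hexConst * u ^ (-(2:ℝ)/3) * (u^2 - 1) ^ (-(1:ℝ)/3)

/-- The measure on `(1,∞)` with density `g(u) du`. -/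
noncomputable def densMeasure (g : ℝ → ℝ) : Measure ℝ :=
  (volume.restrict (Set.Ioi (1:ℝ))).withDensity (fun u => ENNReal.ofReal (g u))

section Helpers
open Filter Topology

lemma jensen_line (Q : ℝ → ℝ) (hc : Continuous Q) (h : ∀ u v, Q u + Q v = Q (u+v) + Q 0) :
    ∃ k, ∀ u, Q u = k * u + Q 0 := by
  let f : ℝ →+ ℝ := AddMonoidHom.mk' (fun u => Q u - Q 0) (by intro a b; have := h a b; linarith)
  have hf : Continuous f := by change Continuous (fun u => Q u - Q 0); fun_prop
  refine ⟨f 1, fun u => ?_⟩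
  have h1 : f (u • (1:ℝ)) = u • f 1 := map_real_smul f hf u 1
  have h2 : f u = Q u - Q 0 := rfl
  simp only [smul_eq_mul, mul_one] at h1
  linarith

lemma jensen_half (G : ℝ → ℝ) (hc : ContinuousOn G (Set.Ioi 0))
    (h : ∀ s t s' t', 0 < s → 0 < t → 0 < s' → 0 < t' → s + t = s' + t' → G s + G t = G s' + G t') :
    ∃ m d, ∀ s, 0 < s → G s = m * s + d := by
  set δ : ℝ → ℝ := fun x => G (1 + max x 0) - G (1 + max (-x) 0) with hδ
  have key : ∀ s x, 0 < s → 0 < s + x → G (s+x) - G s = δ x := by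
    intro s x hs hsx
    rcases le_total 0 x with hx | hx
    · simp only [hδ]
      rw [max_eq_left hx, max_eq_right (by linarith)]
      have := h (s+x) (1+0) s (1+x) hsx (by norm_num) hs (by linarith) (by ring)
      linarith
    · simp only [hδ]
      rw [max_eq_right hx, max_eq_left (by linarith)]
      have := h (s+x) (1+-x) s (1+0) hsx (by linarith) hs (by norm_num) (by ring)
      linarith
  have hδc : Continuous δ := by
    apply Continuous.sub
    · apply hc.comp_continuous (by fun_prop)
      intro x; have := le_max_right x 0; simp only [Set.mem_Ioi]; linarith
    · apply hc.comp_continuous (by fun_prop)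
      intro x; have := le_max_right (-x) 0; simp only [Set.mem_Ioi]; linarith
  have h0 : δ 0 = 0 := by simp [hδ]
  obtain ⟨k, hk⟩ := jensen_line δ hδc (by
    intro u v
    have hu := abs_nonneg u
    have hv := abs_nonneg v
    have hu1 := neg_abs_le u
    have hv1 := neg_abs_le v
    have a1 := key (1 + |u| + |v|) u (by linarith) (by linarith)
    have a2 := key (1 + |u| + |v| + u) v (by linarith) (by linarith)
    have a3 := key (1 + |u| + |v|) (u+v) (by linarith) (by linarith)
    rw [← add_assoc] at a3
    rw [h0]; linarith)
  refine ⟨k, G 1 - k, fun s hs => ?_⟩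
  have := key 1 (s-1) one_pos (by linarith)
  rw [hk, h0] at this
  simp only [add_sub_cancel] at this
  linarith

noncomputable def lamD (p q r : ℝ) : ℝ :=
  2 + p^2 + q^2 + r^2 + 2 * (√(1+p^2) * √(1+q^2) * √(1+r^2))

noncomputable def lam (p q r : ℝ) : ℝ := √(lamD p q r) / (p*q*r)

noncomputable def lamInf (p q e : ℝ) : ℝ :=
  √(e^2 * (2 + p^2 + q^2) + 1 + 2 * e * (√(1+p^2) * √(1+q^2) * √(1+e^2))) / (p*q)

lemma lamD_pos (p q r : ℝ) : 0 < lamD p q r := by unfold lamD; positivity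

lemma lam_pos {p q r : ℝ} (hp : 0 < p) (hq : 0 < q) (hr : 0 < r) : 0 < lam p q r := by
  have := lamD_pos p q r
  unfold lam; positivity

lemma lam_inv {p q e : ℝ} (he : 0 < e) :
    lam p q (1/e) = lamInf p q e := by
  unfold lam lamInf
  have h1 : √(1 + (1/e)^2) = √(1+e^2) / e := by
    rw [show 1 + (1/e)^2 = (1+e^2) / e^2 by field_simp; ring, Real.sqrt_div (by positivity), Real.sqrt_sq he.le]
  have h2 : lamD p q (1/e) = (e^2 * (2 + p^2 + q^2) + 1 + 2 * e * (√(1+p^2) * √(1+q^2) * √(1+e^2))) / e^2 := by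
    unfold lamD; rw [h1]; field_simp
  rw [h2, Real.sqrt_div (by positivity), Real.sqrt_sq he.le]
  field_simp

lemma lamInf_zero (p q : ℝ) : lamInf p q 0 = 1/(p*q) := by simp [lamInf]

lemma sig_zero (p q : ℝ) : √(lamD p q 0) = √(1+p^2) + √(1+q^2) := by
  have a := Real.sq_sqrt (show 0 ≤ 1+p^2 by positivity)
  have b := Real.sq_sqrt (show 0 ≤ 1+q^2 by positivity)
  rw [show lamD p q 0 = (√(1+p^2) + √(1+q^2))^2 by unfold lamD; simp; nlinarith]
  exact Real.sqrt_sq (by positivity)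

lemma lamInf_cont {p q e : ℝ} (hp : 0 < p) (hq : 0 < q) :
    ContinuousAt (fun x : ℝ × ℝ => lamInf p x.1 x.2) (q, e) := by
  unfold lamInf
  apply ContinuousAt.div
  · fun_prop
  · fun_prop
  · simp; exact ⟨hp.ne', hq.ne'⟩

attribute [irreducible] lamInf lam lamD

lemma lamInf_lim {p x : ℝ} (hp : 0 < p) (hx : 0 < x) {ι : Type*} {l : Filter ι} {ε : ι → ℝ}
    (hε0 : Tendsto ε l (𝓝 0)) : Tendsto (fun i => lamInf p x (ε i)) l (𝓝 (1/(p*x))) := by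
  have h1 : Tendsto (fun i => ((x, ε i) : ℝ × ℝ)) l (𝓝 (x, 0)) :=
    tendsto_const_nhds.prodMk_nhds hε0
  have h2 : Tendsto (fun y : ℝ × ℝ => lamInf p y.1 y.2) (𝓝 (x, 0)) (𝓝 (lamInf p x 0)) :=
    lamInf_cont hp hx
  rw [lamInf_zero p x] at h2
  have h3 := h2.comp h1
  exact h3

section FE
variable {g η : ℝ → ℝ}

lemma fe_step1 (hg : ContinuousOn g (Set.Ioi 0)) (hη : ContinuousOn η (Set.Ioi 0))
    (hfe : ∀ p q r, 0 < p → 0 < q → 0 < r →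
      g p + g q + g r = η (lam p q r * p) + η (lam p q r * q) + η (lam p q r * r))
    {p q : ℝ} (hp : 0 < p) (hq : 0 < q) {ι : Type*} {l : Filter ι} {ν ε : ι → ℝ}
    (hν : Tendsto ν l (𝓝 (1/(p*q)))) (hε : Tendsto ε l (𝓝[>] 0)) :
    Tendsto (fun i => η (ν i / ε i) - g (1 / ε i)) l
      (𝓝 ((g p - η (1/p)) + (g q - η (1/q)))) := by
  have gc : ∀ x, 0 < x → ContinuousAt g x := fun x hx => hg.continuousAt (Ioi_mem_nhds hx)
  have ηc : ∀ x, 0 < x → ContinuousAt η x := fun x hx => hη.continuousAt (Ioi_mem_nhds hx)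
  -- continuity of the right-hand side
  let R : ℝ × ℝ → ℝ := fun x => g p + g x.1 - η (x.2 * p) - η (x.2 * x.1)
  have hR : ContinuousAt R (q, 1/(p*q)) := by
    have e1 : ContinuousAt (fun x : ℝ × ℝ => g x.1) (q, 1/(p*q)) :=
      ContinuousAt.comp (g := g) (f := Prod.fst) (gc q hq) continuousAt_fst
    have e2 : ContinuousAt (fun x : ℝ × ℝ => η (x.2 * p)) (q, 1/(p*q)) :=
      ContinuousAt.comp (g := η) (f := fun x : ℝ × ℝ => x.2 * p) (ηc _ (by positivity)) (by fun_prop)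
    have e3 : ContinuousAt (fun x : ℝ × ℝ => η (x.2 * x.1)) (q, 1/(p*q)) :=
      ContinuousAt.comp (g := η) (f := fun x : ℝ × ℝ => x.2 * x.1) (ηc _ (by positivity)) (by fun_prop)
    exact ((continuousAt_const.add e1).sub e2).sub e3
  have hRv : R (q, 1/(p*q)) = (g p - η (1/p)) + (g q - η (1/q)) := by
    simp only [R]
    rw [show 1/(p*q)*p = 1/q by field_simp, show 1/(p*q)*q = 1/p by field_simp]; ring
  rw [← hRv, tendsto_def]
  intro s hs
  have hs' := hR hs
  rw [mem_map, nhds_prod_eq] at hs'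
  obtain ⟨U, hU, V, hV, hUV⟩ := mem_prod_iff.1 hs'
  obtain ⟨δ0, hδ0, hball⟩ := Metric.mem_nhds_iff.1 hU
  set δ := min (δ0/2) (q/2) with hδ
  have hδpos : 0 < δ := lt_min (by linarith) (by linarith)
  have hδ1 : δ ≤ δ0/2 := min_le_left _ _
  have hδ2 : δ ≤ q/2 := min_le_right _ _
  have hε0 : Tendsto ε l (𝓝 0) := hε.mono_right nhdsWithin_le_nhds
  have lims : ∀ x, 0 < x → Tendsto (fun i => lamInf p x (ε i)) l (𝓝 (1/(p*x))) :=
    fun x hx => lamInf_lim hp hx hε0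
  have l1 := lims (q - δ) (by linarith)
  have l2 := lims (q + δ) (by linarith)
  have o1 : 1/(p*q) < 1/(p*(q-δ)) := by
    apply one_div_lt_one_div_of_lt
    · apply mul_pos hp; linarith
    · apply mul_lt_mul_of_pos_left _ hp; linarith
  have o2 : 1/(p*(q+δ)) < 1/(p*q) := by
    apply one_div_lt_one_div_of_lt
    · apply mul_pos hp; linarith
    · apply mul_lt_mul_of_pos_left _ hp; linarith
  have ev1 := hν.eventually_lt l1 o1
  have ev2 := l2.eventually_lt hν o2
  have ev3 : ∀ᶠ i in l, 0 < ε i := hε.eventually self_mem_nhdsWithin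
  have ev4 := hν.eventually hV
  filter_upwards [ev1, ev2, ev3, ev4] with i h1 h2 h3 h4
  have hcont : ContinuousOn (fun x => lamInf p x (ε i)) (Set.Icc (q-δ) (q+δ)) := by
    intro x hx
    have hx0 : 0 < x := by linarith [hx.1]
    apply ContinuousAt.continuousWithinAt
    exact ContinuousAt.comp (g := fun x : ℝ × ℝ => lamInf p x.1 x.2) (f := fun x => (x, ε i))
      (lamInf_cont hp hx0) (by fun_prop)
  obtain ⟨y, hy, hyν⟩ := intermediate_value_Icc' (by linarith) hcont ⟨h2.le, h1.le⟩
  have hy0 : 0 < y := by linarith [hy.1]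
  have hyU : y ∈ U := by
    apply hball
    rw [Metric.mem_ball, Real.dist_eq, abs_lt]
    constructor <;> linarith [hy.1, hy.2]
  have hmem : R (y, ν i) ∈ s := hUV (Set.mk_mem_prod hyU h4)
  have hE := hfe p y (1/ε i) hp hy0 (by positivity)
  simp only at hyν
  rw [lam_inv h3, hyν] at hE
  rw [Set.mem_preimage]
  convert hmem using 1
  simp only [R]
  rw [show ν i / ε i = ν i * (1/ε i) by ring]
  linarith

theorem fe_main (hg : ContinuousOn g (Set.Ioi 0)) (hη : ContinuousOn η (Set.Ioi 0))
    (hfe : ∀ p q r, 0 < p → 0 < q → 0 < r →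
      g p + g q + g r = η (lam p q r * p) + η (lam p q r * q) + η (lam p q r * r)) :
    ∃ d, ∀ p, 0 < p → η p = d := by
  have gc : ∀ x, 0 < x → ContinuousAt g x := fun x hx => hg.continuousAt (Ioi_mem_nhds hx)
  have ηc : ∀ x, 0 < x → ContinuousAt η x := fun x hx => hη.continuousAt (Ioi_mem_nhds hx)
  have idl : Tendsto (fun e : ℝ => e) (𝓝[>] (0:ℝ)) (𝓝[>] 0) := tendsto_id
  have idl0 : Tendsto (fun e : ℝ => e) (𝓝[>] (0:ℝ)) (𝓝 0) := nhdsWithin_le_nhds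
  obtain ⟨k, c, hP⟩ : ∃ k c, ∀ p, 0 < p → g p - η (1/p) = k * Real.log p + c := by
    obtain ⟨k, hk⟩ := jensen_line (fun u => g (Real.exp u) - η (1/Real.exp u)) (by
        apply Continuous.sub
        · exact hg.comp_continuous Real.continuous_exp (fun x => Real.exp_pos x)
        · refine hη.comp_continuous (continuous_const.div Real.continuous_exp (fun x => (Real.exp_pos x).ne')) (fun x => ?_)
          have := Real.exp_pos x
          simp only [Set.mem_Ioi]; positivity) (by
        intro u v
        have a := fe_step1 hg hη hfe (Real.exp_pos u) (Real.exp_pos v)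
          (tendsto_const_nhds (f := 𝓝[>] (0:ℝ))) idl
        have b := fe_step1 hg hη hfe (Real.exp_pos (u+v)) (Real.exp_pos 0)
          (tendsto_const_nhds (f := 𝓝[>] (0:ℝ))) idl
        rw [Real.exp_add, Real.exp_zero, mul_one] at b
        have := tendsto_nhds_unique a b
        simp only [Real.exp_add, Real.exp_zero]
        exact this)
    refine ⟨k, g (Real.exp 0) - η (1/Real.exp 0), fun p hp => ?_⟩
    have := hk (Real.log p)
    simp only [Real.exp_log hp] at this
    exact this
  have D : ∀ {x : ℝ} {ν : ℝ → ℝ}, 0 < x → Tendsto ν (𝓝[>] (0:ℝ)) (𝓝 x) →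
      Tendsto (fun e => η (ν e / e) - g (1/e)) (𝓝[>] (0:ℝ)) (𝓝 (-k * Real.log x + 2*c)) := by
    intro x ν hx hν
    have := fe_step1 hg hη hfe (p := 1/x) (q := 1) (by positivity) one_pos (l := 𝓝[>] (0:ℝ)) (ν := ν) (by simpa using hν) idl
    rw [hP _ (by positivity), hP 1 one_pos] at this
    simp only [one_div, Real.log_inv, Real.log_one] at this ⊢
    convert this using 2
    ring
  have S : ∀ {x : ℝ} {ν : ℝ → ℝ}, 0 < x → Tendsto ν (𝓝[>] (0:ℝ)) (𝓝 x) →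
      Tendsto (fun e => η (ν e / e) - η (1/e)) (𝓝[>] (0:ℝ)) (𝓝 (-k * Real.log x)) := by
    intro x ν hx hν
    have a := D hx hν
    have b := D one_pos (tendsto_const_nhds (f := 𝓝[>] (0:ℝ)))
    convert a.sub b using 2
    · ring
    · simp
  -- second degenerate limit
  have M : ∀ p q, 0 < p → 0 < q → Tendsto (fun e => 2 * η (1/e) - g e) (𝓝[>] (0:ℝ))
      (𝓝 (g p + g q - η ((√(1+p^2) + √(1+q^2))/(p*q)) + k * Real.log ((√(1+p^2) + √(1+q^2))/(p*q) * p)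
        + k * Real.log ((√(1+p^2) + √(1+q^2))/(p*q) * q))) := by
    intro p q hp hq
    set σ0 := (√(1+p^2) + √(1+q^2))/(p*q) with hσ0
    have hσpos : 0 < σ0 := by positivity
    set σ : ℝ → ℝ := fun e => √(lamD p q e) / (p*q) with hσ
    have hσt : Tendsto σ (𝓝[>] (0:ℝ)) (𝓝 σ0) := by
      have : σ 0 = σ0 := by simp only [hσ, hσ0, sig_zero]
      rw [← this]
      apply Tendsto.mono_left _ nhdsWithin_le_nhds
      apply Continuous.tendsto
      simp only [hσ, lamD]
      fun_prop
    have s1 := S (x := σ0 * p) (ν := fun e => σ e * p) (by positivity) (hσt.mul_const p)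
    have s2 := S (x := σ0 * q) (ν := fun e => σ e * q) (by positivity) (hσt.mul_const q)
    have s3 : Tendsto (fun e => η (σ e)) (𝓝[>] (0:ℝ)) (𝓝 (η σ0)) := (ηc _ hσpos).tendsto.comp hσt
    have s4 : Tendsto (fun e : ℝ => g p + g q) (𝓝[>] (0:ℝ)) (𝓝 (g p + g q)) := tendsto_const_nhds
    have := ((s4.sub s3).sub s1).sub s2
    have hl : (g p + g q - η σ0 - -k * Real.log (σ0 * p) - -k * Real.log (σ0 * q)) = (g p + g q - η σ0 + k * Real.log (σ0 * p) + k * Real.log (σ0 * q)) := by ring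
    rw [hl] at this
    refine this.congr' ?_
    filter_upwards [self_mem_nhdsWithin] with e he
    have he : 0 < e := he
    have hE := hfe p q e hp hq he
    have hlam : lam p q e = σ e / e := by
      simp only [lam, hσ]; field_simp
    rw [hlam] at hE
    rw [show σ e / e * e = σ e by field_simp, show σ e / e * p = σ e * p / e by ring, show σ e / e * q = σ e * q / e by ring] at hE
    linarith
  have sinh_id : ∀ s t, 0 < s → 0 < t →
      (√(1+(1/Real.sinh s)^2) + √(1+(1/Real.sinh t)^2))/((1/Real.sinh s)*(1/Real.sinh t)) = Real.sinh (s+t) := by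
    have aux : ∀ s, 0 < s → √(1+(1/Real.sinh s)^2) = Real.cosh s / Real.sinh s := by
      intro s hs
      have h1 := Real.sinh_pos_iff.2 hs
      rw [show 1+(1/Real.sinh s)^2 = (Real.cosh s / Real.sinh s)^2 by
        have := Real.cosh_sq s
        field_simp; linarith]
      exact Real.sqrt_sq (by have := Real.cosh_pos s; positivity)
    intro s t hs ht
    have h1 := Real.sinh_pos_iff.2 hs
    have h2 := Real.sinh_pos_iff.2 ht
    rw [aux s hs, aux t ht, Real.sinh_add]
    field_simp
    ring
  obtain ⟨m, d, hG⟩ := jensen_half (fun s => g (1/Real.sinh s) - k * Real.log (Real.sinh s)) (by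
      intro s hs
      have h1 := Real.sinh_pos_iff.2 hs
      apply ContinuousAt.continuousWithinAt
      apply ContinuousAt.sub
      · exact ContinuousAt.comp (g := g) (f := fun s => 1/Real.sinh s) (gc _ (by positivity))
          (continuousAt_const.div Real.continuous_sinh.continuousAt h1.ne')
      · exact continuousAt_const.mul (Real.continuous_sinh.continuousAt.log h1.ne')) (by
      intro s t s' t' hs ht hs' ht' hst
      have p1 := Real.sinh_pos_iff.2 hs
      have p2 := Real.sinh_pos_iff.2 ht
      have p3 := Real.sinh_pos_iff.2 hs'
      have p4 := Real.sinh_pos_iff.2 ht'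
      have p5 := Real.sinh_pos_iff.2 (add_pos hs ht)
      have a := M (1/Real.sinh s) (1/Real.sinh t) (by positivity) (by positivity)
      have b := M (1/Real.sinh s') (1/Real.sinh t') (by positivity) (by positivity)
      rw [sinh_id s t hs ht] at a
      rw [sinh_id s' t' hs' ht', ← hst] at b
      have e := tendsto_nhds_unique a b
      have lg : ∀ x, 0 < x → Real.log (Real.sinh (s+t) * (1/x)) = Real.log (Real.sinh (s+t)) - Real.log x := by
        intro x hx
        rw [mul_one_div, Real.log_div p5.ne' hx.ne']
      rw [lg _ p1, lg _ p2, lg _ p3, lg _ p4] at e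
      linarith)
  have gF : ∀ p, 0 < p → g p = m * Real.arsinh (1/p) - k * Real.log p + d := by
    intro p hp
    have := hG (Real.arsinh (1/p)) (Real.arsinh_pos_iff.2 (by positivity))
    simp only [Real.sinh_arsinh, one_div, inv_inv, Real.log_inv] at this ⊢
    linarith
  have ηF : ∀ p, 0 < p → η p = m * Real.arsinh p + 2 * k * Real.log p + (d - c) := by
    intro p hp
    have := hP (1/p) (by positivity)
    rw [gF _ (by positivity)] at this
    simp only [one_div, inv_inv, Real.log_inv] at this
    linarith
  have log2 : 0 < Real.log 2 := Real.log_pos (by norm_num)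
  have hmk : m = -3 * k := by
    have a := S (x := 2) (ν := fun _ => 2) (by norm_num) tendsto_const_nhds
    have b : Tendsto (fun e : ℝ => m * Real.log ((2 + √(e^2+4))/(1+√(e^2+1))) + 2 * k * Real.log 2) (𝓝[>] (0:ℝ))
        (𝓝 (m * Real.log ((2 + √((0:ℝ)^2+4))/(1+√((0:ℝ)^2+1))) + 2 * k * Real.log 2)) := by
      apply Tendsto.mono_left _ nhdsWithin_le_nhds
      apply ContinuousAt.tendsto (f := fun e : ℝ => m * Real.log ((2 + √(e^2+4))/(1+√(e^2+1))) + 2 * k * Real.log 2)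
      have : ∀ e : ℝ, 1 + √(e^2+1) ≠ 0 := fun e => by positivity
      refine ContinuousAt.add (continuousAt_const.mul (ContinuousAt.log ?_ (by positivity))) continuousAt_const
      exact ContinuousAt.div (f := fun e : ℝ => 2 + √(e^2+4)) (g := fun e : ℝ => 1 + √(e^2+1)) (by fun_prop) (by fun_prop) (this 0)
    have e := tendsto_nhds_unique a (b.congr' ?_)
    · rw [show √((0:ℝ)^2+4) = 2 by rw [show (0:ℝ)^2+4 = 2^2 by norm_num]; exact Real.sqrt_sq (by norm_num)] at e
      norm_num at e
      have : Real.log 2 * (m + 3 * k) = 0 := by linarith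
      rcases mul_eq_zero.1 this with h | h
      · exact absurd h log2.ne'
      · linarith
    · filter_upwards [self_mem_nhdsWithin] with e he
      have he : 0 < e := he
      rw [ηF _ (by positivity), ηF _ (by positivity)]
      have r1 : Real.arsinh (2/e) = Real.log (2 + √(e^2+4)) - Real.log e := by
        rw [Real.arsinh, ← Real.log_div (by positivity) he.ne']
        congr 1
        rw [show 1 + (2/e)^2 = (e^2+4)/e^2 by field_simp; ring, Real.sqrt_div (by positivity), Real.sqrt_sq he.le]
        field_simp
      have r2 : Real.arsinh (1/e) = Real.log (1 + √(e^2+1)) - Real.log e := by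
        rw [Real.arsinh, ← Real.log_div (by positivity) he.ne']
        congr 1
        rw [show 1 + (1/e)^2 = (e^2+1)/e^2 by field_simp, Real.sqrt_div (by positivity), Real.sqrt_sq he.le]
        field_simp
      rw [r1, r2, Real.log_div (by positivity) (by positivity), Real.log_div (by positivity) (by positivity), Real.log_div (by positivity) (by positivity)]
      simp; ring
  have hk0 : k = 0 := by
    by_contra hk
    have s3 := Real.sq_sqrt (show (0:ℝ) ≤ 3 by norm_num)
    have s5 := Real.sq_sqrt (show (0:ℝ) ≤ 5 by norm_num)
    have s8 := Real.sq_sqrt (show (0:ℝ) ≤ 8 by norm_num)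
    have p3 : 0 < √(3:ℝ) := by positivity
    have p5 : 0 < √(5:ℝ) := by positivity
    have p8 : 0 < √(8:ℝ) := by positivity
    have q4 : √(4:ℝ) = 2 := by rw [show (4:ℝ) = 2^2 by norm_num]; exact Real.sqrt_sq (by norm_num)
    have q9 : √(9:ℝ) = 3 := by rw [show (9:ℝ) = 3^2 by norm_num]; exact Real.sqrt_sq (by norm_num)
    -- first point
    have l1 : lam √3 √3 √3 * √3 = √3 := by
      unfold lam lamD
      rw [s3]; norm_num [q4]
      rw [show (27:ℝ) = 3^2 * 3 by norm_num, Real.sqrt_mul (by norm_num), Real.sqrt_sq (by norm_num)]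
      field_simp
    have l2 : lam √8 √8 √8 * √8 = √5/2 := by
      unfold lam lamD
      rw [s8]; norm_num [q9]
      rw [show (80:ℝ) = 4^2 * 5 by norm_num, Real.sqrt_mul (by norm_num), Real.sqrt_sq (by norm_num)]
      field_simp; nlinarith
    have E1 := hfe √3 √3 √3 p3 p3 p3
    have E2 := hfe √8 √8 √8 p8 p8 p8
    rw [l1, gF _ p3, ηF _ p3] at E1
    rw [l2, gF _ p8, ηF _ (by positivity)] at E2
    have t1 : Real.arsinh (1/√3) = Real.log 3 - Real.log √3 := by
      rw [Real.arsinh, ← Real.log_div (by norm_num) p3.ne']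
      congr 1
      rw [div_pow, s3, show (1:ℝ) + 1^2/3 = 4/3 by norm_num, Real.sqrt_div (by norm_num), q4]
      field_simp; norm_num
    have t2 : Real.arsinh √3 = Real.log (√3 + 2) := by
      rw [Real.arsinh, s3, show (1:ℝ)+3 = 4 by norm_num, q4]
    have t3 : Real.arsinh (1/√8) = Real.log 4 - Real.log √8 := by
      rw [Real.arsinh, ← Real.log_div (by norm_num) p8.ne']
      congr 1
      rw [div_pow, s8, show (1:ℝ) + 1^2/8 = 9/8 by norm_num, Real.sqrt_div (by norm_num), q9]
      field_simp; norm_num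
    have t4 : Real.arsinh (√5/2) = Real.log (√5 + 3) - Real.log 2 := by
      rw [Real.arsinh, ← Real.log_div (by positivity) (by norm_num)]
      congr 1
      rw [div_pow, s5, show (1:ℝ) + 5/2^2 = 9/2^2 by norm_num, Real.sqrt_div (by norm_num), q9, Real.sqrt_sq (by norm_num)]
      ring
    have u3 : Real.log √3 = Real.log 3 / 2 := Real.log_sqrt (by norm_num)
    have u8 : Real.log √8 = 3 * Real.log 2 / 2 := by
      rw [Real.log_sqrt (by norm_num), show (8:ℝ) = 2^3 by norm_num, Real.log_pow]; norm_num
    have u4 : Real.log 4 = 2 * Real.log 2 := by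
      rw [show (4:ℝ) = 2^2 by norm_num, Real.log_pow]; norm_num
    have u5 : Real.log (√5/2) = Real.log 5/2 - Real.log 2 := by
      rw [Real.log_div p5.ne' (by norm_num), Real.log_sqrt (by norm_num)]
    rw [t1, t2, u3] at E1
    rw [t3, t4, u8, u4, u5] at E2
    have F : k * (3 * Real.log (√3+2) - 3 * Real.log 3) = k * (3 * Real.log (√5+3) - 4 * Real.log 2 - Real.log 5) := by
      rw [hmk] at E1 E2
      linarith
    have F' := mul_left_cancel₀ hk F
    have w1 : 3 * Real.log (√3+2) - 3 * Real.log 3 = Real.log ((√3+2)^3/27) := by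
      rw [Real.log_div (by positivity) (by norm_num), Real.log_pow, show (27:ℝ) = 3^3 by norm_num, Real.log_pow]
      norm_num
    have w2 : 3 * Real.log (√5+3) - 4 * Real.log 2 - Real.log 5 = Real.log ((√5+3)^3/80) := by
      rw [Real.log_div (by positivity) (by norm_num), Real.log_pow, show (80:ℝ) = 2^4*5 by norm_num, Real.log_mul (by norm_num) (by norm_num), Real.log_pow]
      norm_num; ring
    rw [w1, w2] at F'
    have F2 := Real.log_injOn_pos (Set.mem_Ioi.2 (by positivity)) (Set.mem_Ioi.2 (by positivity)) F'
    have x1 : (√3+2)^3 = 26 + 15 * √3 := by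
      have : (√3+2)^3 = √3^2*√3 + 6*√3^2+12*√3+8 := by ring
      rw [this, s3]; ring
    have x2 : (√5+3)^3 = 72 + 32 * √5 := by
      have : (√5+3)^3 = √5^2*√5 + 9*√5^2+27*√5+27 := by ring
      rw [this, s5]; ring
    rw [x1, x2] at F2
    have y1 : (17/10:ℝ) < √3 := Real.lt_sqrt_of_sq_lt (by norm_num)
    have y2 : √5 < (9/4:ℝ) := by rw [Real.sqrt_lt' (by norm_num)]; norm_num
    linarith
  refine ⟨d - c, fun p hp => ?_⟩
  rw [ηF p hp, hmk, hk0]; ring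
end FE

lemma lam_swap12 (p q r : ℝ) : lam p q r = lam q p r := by
  unfold lam lamD
  rw [mul_comm p q, mul_comm √(1+p^2), show 2 + p^2 + q^2 = 2 + q^2 + p^2 by ring]

lemma lam_rot (p q r : ℝ) : lam p q r = lam r p q := by
  unfold lam lamD
  congr 1
  · congr 1; ring
  · ring

lemma sq1 (p : ℝ) : √(1+p^2)^2 = 1 + p^2 := Real.sq_sqrt (by positivity)

lemma lam_sq {p q r : ℝ} (hp : 0 < p) (hq : 0 < q) (hr : 0 < r) :
    lam p q r ^ 2 * (p*q*r)^2 = lamD p q r := by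
  unfold lam
  rw [div_pow, Real.sq_sqrt (lamD_pos p q r).le]
  field_simp

lemma cosh_lam {p q r : ℝ} (hp : 0 < p) (hq : 0 < q) (hr : 0 < r) :
    √(1 + (lam p q r * p)^2) = (√(1+p^2) + √(1+q^2) * √(1+r^2)) / (q*r) := by
  have h := lam_sq hp hq hr
  unfold lamD at h
  have a := sq1 p
  have b := sq1 q
  have c := sq1 r
  rw [show 1 + (lam p q r * p)^2 = ((√(1+p^2) + √(1+q^2) * √(1+r^2)) / (q*r))^2 by
    rw [div_pow, eq_div_iff (by positivity)]
    have : (1 + (lam p q r * p)^2) * (q*r)^2 = (q*r)^2 + lam p q r ^ 2 * (p*q*r)^2 := by ring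
    rw [this, h, add_sq, mul_pow √(1+q^2), a, b, c]
    ring]
  exact Real.sqrt_sq (by positivity)

lemma cosh_lam2 {p q r : ℝ} (hp : 0 < p) (hq : 0 < q) (hr : 0 < r) :
    √(1 + (lam p q r * q)^2) = (√(1+q^2) + √(1+p^2) * √(1+r^2)) / (p*r) := by
  rw [lam_swap12]; exact cosh_lam hq hp hr

lemma cosh_lam3 {p q r : ℝ} (hp : 0 < p) (hq : 0 < q) (hr : 0 < r) :
    √(1 + (lam p q r * r)^2) = (√(1+r^2) + √(1+p^2) * √(1+q^2)) / (p*q) := by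
  rw [lam_rot]; exact cosh_lam hr hp hq

lemma lam_invol {p q r : ℝ} (hp : 0 < p) (hq : 0 < q) (hr : 0 < r) :
    lam (lam p q r * p) (lam p q r * q) (lam p q r * r) * lam p q r = 1 := by
  have hl := lam_pos hp hq hr
  have h := lam_sq hp hq hr
  have hD : lamD (lam p q r * p) (lam p q r * q) (lam p q r * r) = (lamD p q r / (p*q*r))^2 := by
    have e : lamD (lam p q r * p) (lam p q r * q) (lam p q r * r)
      = 2 + lam p q r ^2 * (p^2 + q^2 + r^2) + 2 * (√(1 + (lam p q r * p)^2) * √(1 + (lam p q r * q)^2) * √(1 + (lam p q r * r)^2)) := by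
      unfold lamD; ring
    rw [e, cosh_lam hp hq hr, cosh_lam2 hp hq hr, cosh_lam3 hp hq hr]
    have a := sq1 p
    have b := sq1 q
    have c := sq1 r
    have hl2 : lam p q r ^2 = lamD p q r / (p*q*r)^2 := by rw [← h]; field_simp
    rw [hl2]
    field_simp
    unfold lamD
    generalize √(1+p^2) = x at *
    generalize √(1+q^2) = y at *
    generalize √(1+r^2) = z at *
    have a' : p^2 = x^2 - 1 := by linarith
    have b' : q^2 = y^2 - 1 := by linarith
    have c' : r^2 = z^2 - 1 := by linarith
    simp only [a', b', c']
    ring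
  have : lam (lam p q r * p) (lam p q r * q) (lam p q r * r)
      = √(lamD (lam p q r * p) (lam p q r * q) (lam p q r * r)) / (lam p q r * p * (lam p q r * q) * (lam p q r * r)) := by
    conv_lhs => unfold lam
    unfold lam; rfl
  rw [this, hD, Real.sqrt_sq (by have := lamD_pos p q r; positivity), ← h]
  field_simp

/-- positive octant -/
def octant : Set (ℝ × ℝ × ℝ) := Set.Ioi 0 ×ˢ (Set.Ioi 0 ×ˢ Set.Ioi 0)

lemma octant_open : IsOpen octant := isOpen_Ioi.prod (isOpen_Ioi.prod isOpen_Ioi)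

noncomputable def lamV (v : ℝ × ℝ × ℝ) : ℝ := lam v.1 v.2.1 v.2.2

noncomputable def Phi (v : ℝ × ℝ × ℝ) : ℝ × ℝ × ℝ := lamV v • v

lemma lamV_pos {v : ℝ × ℝ × ℝ} (hv : v ∈ octant) : 0 < lamV v := lam_pos hv.1 hv.2.1 hv.2.2

lemma Phi_mem {v : ℝ × ℝ × ℝ} (hv : v ∈ octant) : Phi v ∈ octant :=
  ⟨mul_pos (lamV_pos hv) hv.1, mul_pos (lamV_pos hv) hv.2.1, mul_pos (lamV_pos hv) hv.2.2⟩

lemma Phi_Phi {v : ℝ × ℝ × ℝ} (hv : v ∈ octant) : Phi (Phi v) = v := by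
  have h : lamV (Phi v) * lamV v = 1 := lam_invol hv.1 hv.2.1 hv.2.2
  have : Phi (Phi v) = lamV (Phi v) • (lamV v • v) := rfl
  rw [this, smul_smul, h, one_smul]

lemma Phi_injOn : Set.InjOn Phi octant := by
  intro v hv w hw h
  rw [← Phi_Phi hv, h, Phi_Phi hw]

lemma lamV_meas : Measurable lamV := by
  unfold lamV lam lamD; fun_prop

lemma Phi_meas : Measurable Phi := by
  unfold Phi; exact lamV_meas.smul measurable_id

lemma lamV_diff {v : ℝ × ℝ × ℝ} (hv : v ∈ octant) : DifferentiableAt ℝ lamV v := by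
  have h1 : (0:ℝ) < v.1 := hv.1
  have h2 : (0:ℝ) < v.2.1 := hv.2.1
  have h3 : (0:ℝ) < v.2.2 := hv.2.2
  have hs : ∀ x : ℝ, 1 + x^2 ≠ 0 := fun x => by positivity
  have e : lamV = fun v : ℝ × ℝ × ℝ => √(lamD v.1 v.2.1 v.2.2) / (v.1 * v.2.1 * v.2.2) := by
    funext v; unfold lamV lam; rfl
  rw [e]
  simp only [div_eq_mul_inv]
  refine DifferentiableAt.mul ?_ (DifferentiableAt.inv ?_ ?_)
  · apply DifferentiableAt.sqrt
    · unfold lamD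
      have d1 : DifferentiableAt ℝ (fun v : ℝ × ℝ × ℝ => √(1 + v.1^2)) v := DifferentiableAt.sqrt (by fun_prop) (hs _)
      have d2 : DifferentiableAt ℝ (fun v : ℝ × ℝ × ℝ => √(1 + v.2.1^2)) v := DifferentiableAt.sqrt (by fun_prop) (hs _)
      have d3 : DifferentiableAt ℝ (fun v : ℝ × ℝ × ℝ => √(1 + v.2.2^2)) v := DifferentiableAt.sqrt (by fun_prop) (hs _)
      have d4 := (d1.mul d2).mul d3
      have d5 : DifferentiableAt ℝ (fun v : ℝ × ℝ × ℝ => 2 + v.1^2 + v.2.1^2 + v.2.2^2) v := by fun_prop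
      exact d5.add (d4.const_mul 2)
    · exact (lamD_pos _ _ _).ne'
  · fun_prop
  · positivity

lemma Phi_hasFDerivAt {v : ℝ × ℝ × ℝ} (hv : v ∈ octant) :
    HasFDerivAt Phi (lamV v • ContinuousLinearMap.id ℝ (ℝ × ℝ × ℝ) + (fderiv ℝ lamV v).smulRight v) v :=
  (lamV_diff hv).hasFDerivAt.smul (hasFDerivAt_id v)

lemma Phi_cont : ContinuousOn Phi octant := fun _ hv =>
  (Phi_hasFDerivAt hv).continuousAt.continuousWithinAt

lemma det_aux (l : ℝ) (hl : l ≠ 0) (f : (ℝ × ℝ × ℝ) →L[ℝ] ℝ) (v : ℝ × ℝ × ℝ) :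
    (l • ContinuousLinearMap.id ℝ (ℝ × ℝ × ℝ) + f.smulRight v).det = l^2 * (l + f v) := by
  have : ((l • ContinuousLinearMap.id ℝ (ℝ × ℝ × ℝ) + f.smulRight v : (ℝ × ℝ × ℝ) →L[ℝ] (ℝ × ℝ × ℝ)) : (ℝ × ℝ × ℝ) →ₗ[ℝ] (ℝ × ℝ × ℝ))
      = l • LinearMap.transvection (l⁻¹ • (f : (ℝ × ℝ × ℝ) →ₗ[ℝ] ℝ)) v := by
    apply LinearMap.ext
    intro x
    simp [LinearMap.transvection.apply, smul_smul, hl]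
  rw [ContinuousLinearMap.det, this, LinearMap.det_smul, LinearMap.transvection.det]
  simp
  field_simp

/-- radial derivative of lam -/
lemma lam_radial {v : ℝ × ℝ × ℝ} (hv : v ∈ octant) :
    lamV v + fderiv ℝ lamV v v = - (√(1 + (lamV v * v.1)^2) * √(1 + (lamV v * v.2.1)^2) * √(1 + (lamV v * v.2.2)^2))
      / (lamV v * (√(1+v.1^2) * √(1+v.2.1^2) * √(1+v.2.2^2))) := by
  obtain ⟨p, q, r⟩ := v
  have hp : (0:ℝ) < p := hv.1
  have hq : (0:ℝ) < q := hv.2.1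
  have hr : (0:ℝ) < r := hv.2.2
  have hD := lamD_pos p q r
  -- chain rule
  have h1 : HasDerivAt (fun t : ℝ => lamV (t • ((p, q, r) : ℝ × ℝ × ℝ))) (fderiv ℝ lamV (p,q,r) (p,q,r)) 1 := by
    have a : HasDerivAt (fun t : ℝ => t • ((p, q, r) : ℝ × ℝ × ℝ)) ((1:ℝ) • ((p, q, r) : ℝ × ℝ × ℝ)) 1 :=
      (hasDerivAt_id (1:ℝ)).smul_const _
    rw [one_smul] at a
    have b : HasFDerivAt lamV (fderiv ℝ lamV (p,q,r)) ((1:ℝ) • ((p, q, r) : ℝ × ℝ × ℝ)) := by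
      rw [one_smul]; exact (lamV_diff hv).hasFDerivAt
    exact b.comp_hasDerivAt 1 a
  have s : ∀ x : ℝ, HasDerivAt (fun t : ℝ => √(1 + (t*x)^2)) (x^2 / √(1+x^2)) 1 := by
    intro x
    have a : HasDerivAt (fun t : ℝ => 1 + (t*x)^2) (2 * x^2) 1 := by
      have := (((hasDerivAt_id (1:ℝ)).mul_const x).pow 2).const_add 1
      refine this.congr_deriv ?_
      simp; ring
    have b := a.sqrt (by positivity)
    convert b using 1
    simp only [one_mul]
    field_simp
  have h2 : HasDerivAt (fun t : ℝ => lamD (t*p) (t*q) (t*r))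
      (2 * (p^2 + q^2 + r^2) + 2 * ((p^2 / √(1+p^2) * √(1+q^2) + √(1+p^2) * (q^2 / √(1+q^2))) * √(1+r^2) + √(1+p^2) * √(1+q^2) * (r^2 / √(1+r^2)))) 1 := by
    have a : HasDerivAt (fun t : ℝ => 2 + (t*p)^2 + (t*q)^2 + (t*r)^2) (2 * (p^2 + q^2 + r^2)) 1 := by
      have := ((((((hasDerivAt_id (1:ℝ)).mul_const p).pow 2).const_add 2).add (((hasDerivAt_id (1:ℝ)).mul_const q).pow 2))).add (((hasDerivAt_id (1:ℝ)).mul_const r).pow 2)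
      refine this.congr_deriv ?_
      simp; ring
    have b := a.add ((((s p).mul (s q)).mul (s r)).const_mul 2)
    have e : (fun t : ℝ => lamD (t*p) (t*q) (t*r)) = fun t : ℝ => (2 + (t*p)^2 + (t*q)^2 + (t*r)^2) + 2 * (√(1 + (t*p)^2) * √(1 + (t*q)^2) * √(1 + (t*r)^2)) := by
      funext t; unfold lamD; rfl
    rw [e]
    refine b.congr_deriv ?_
    simp
  have h3 := (h2.sqrt (by simpa using hD.ne')).div
    ((((hasDerivAt_id (1:ℝ)).mul_const p).mul ((hasDerivAt_id (1:ℝ)).mul_const q)).mul ((hasDerivAt_id (1:ℝ)).mul_const r))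
    (by simp; exact ⟨⟨hp.ne', hq.ne'⟩, hr.ne'⟩)
  have h4 := h1.unique (h3.congr_of_eventuallyEq (Filter.Eventually.of_forall (fun t => by
    simp [lamV, lam])))
  rw [h4]
  have hl : lamV (p,q,r) = lam p q r := rfl
  simp only [hl]
  rw [cosh_lam hp hq hr, cosh_lam2 hp hq hr, cosh_lam3 hp hq hr]
  have hle : lam p q r = √(lamD p q r) / (p*q*r) := by unfold lam; rfl
  rw [hle]
  simp only [one_mul, id, Pi.mul_apply, Pi.pow_apply]
  have hS : 0 < √(lamD p q r) := Real.sqrt_pos.2 hD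
  have hS2 : √(lamD p q r)^2 = lamD p q r := Real.sq_sqrt hD.le
  have a := sq1 p
  have b := sq1 q
  have c := sq1 r
  have hx : 0 < √(1+p^2) := by positivity
  have hy : 0 < √(1+q^2) := by positivity
  have hz : 0 < √(1+r^2) := by positivity
  generalize √(lamD p q r) = S at *
  have hS3 : S^2 = 2 + p^2 + q^2 + r^2 + 2 * (√(1+p^2) * √(1+q^2) * √(1+r^2)) := by
    rw [hS2]; unfold lamD; rfl
  clear h1 h2 h3 h4 s hS2 hle
  generalize √(1+p^2) = x at *
  generalize √(1+q^2) = y at *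
  generalize √(1+r^2) = z at *
  have a' : p^2 = x^2 - 1 := by linarith
  have b' : q^2 = y^2 - 1 := by linarith
  have c' : r^2 = z^2 - 1 := by linarith
  field_simp
  rw [hS3]
  simp only [a', b', c']
  ring

lemma Phi_det {v : ℝ × ℝ × ℝ} (hv : v ∈ octant) :
    |(lamV v • ContinuousLinearMap.id ℝ (ℝ × ℝ × ℝ) + (fderiv ℝ lamV v).smulRight v).det|
     = lamV v * ((√(1 + (lamV v * v.1)^2) * √(1 + (lamV v * v.2.1)^2) * √(1 + (lamV v * v.2.2)^2))
      / (√(1+v.1^2) * √(1+v.2.1^2) * √(1+v.2.2^2))) := by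
  have hl := lamV_pos hv
  rw [det_aux _ hl.ne', lam_radial hv, abs_mul, neg_div, abs_neg, abs_of_nonneg (by positivity), abs_of_nonneg (by positivity)]
  field_simp

/-- the coordinate change -/
noncomputable def Tm (a : ℝ) : ℝ := (a - a⁻¹)/2

lemma Tm_pos {a : ℝ} (ha : 1 < a) : 0 < Tm a := by
  unfold Tm
  have := inv_lt_one_of_one_lt₀ ha
  linarith

lemma Tm_sqrt {a : ℝ} (ha : 1 < a) : √(1 + Tm a ^ 2) = (a + a⁻¹)/2 := by
  have : 0 < a := by linarith
  rw [show 1 + Tm a ^ 2 = ((a + a⁻¹)/2)^2 by unfold Tm; field_simp; ring]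
  exact Real.sqrt_sq (by positivity)

lemma Tm_hexA {a b c : ℝ} (ha : 1 < a) (hb : 1 < b) (hc : 1 < c) :
    Tm (hexA a b c) = lam (Tm a) (Tm b) (Tm c) * Tm a := by
  have a0 : 0 < a := by linarith
  have b0 : 0 < b := by linarith
  have c0 : 0 < c := by linarith
  have hTa := Tm_pos ha
  have hTb := Tm_pos hb
  have hTc := Tm_pos hc
  have a1 : 0 < a^2 - 1 := by nlinarith
  have b1 : 0 < b^2 - 1 := by nlinarith
  have c1 : 0 < c^2 - 1 := by nlinarith
  have hD : lamD (Tm a) (Tm b) (Tm c) = (1+a*b*c)*(a+b*c)*((b+a*c)*(c+a*b)) / (2*(a*b*c))^2 := by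
    unfold lamD
    rw [Tm_sqrt ha, Tm_sqrt hb, Tm_sqrt hc]
    unfold Tm
    field_simp
    ring
  have hR : √(ratioA a b c) = √((1+a*b*c)*(a+b*c)*((b+a*c)*(c+a*b))) / ((b+a*c)*(c+a*b)) := by
    rw [show ratioA a b c = (1+a*b*c)*(a+b*c)*((b+a*c)*(c+a*b)) / ((b+a*c)*(c+a*b))^2 by
      unfold ratioA; field_simp]
    rw [Real.sqrt_div (by positivity), Real.sqrt_sq (by positivity)]
  set R := √(ratioA a b c) with hRdef
  have hr : ratioA a b c - 1 = a * (b^2-1) * (c^2-1) / ((b+a*c)*(c+a*b)) := by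
    unfold ratioA; field_simp; ring
  have hr0 : 0 < a * (b^2-1) * (c^2-1) / ((b+a*c)*(c+a*b)) := by positivity
  have hR2 : R^2 = ratioA a b c := Real.sq_sqrt (by linarith)
  have hR0 : 0 ≤ R := Real.sqrt_nonneg _
  have hR1 : 1 < R := by nlinarith
  have e1 : Tm (hexA a b c) = 2 * R / (R^2 - 1) := by
    have h1 : R - 1 ≠ 0 := by linarith
    have h2 : R + 1 ≠ 0 := by linarith
    have h3 : R^2 - 1 ≠ 0 := by nlinarith
    unfold Tm hexA
    rw [← hRdef, inv_div, div_sub_div _ _ h1 h2, div_div, div_eq_div_iff (by positivity) h3]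
    ring
  rw [e1, hR2, hr, hR]
  unfold lam
  rw [hD, Real.sqrt_div (by positivity), Real.sqrt_sq (by positivity)]
  generalize √((1+a*b*c)*(a+b*c)*((b+a*c)*(c+a*b))) = S
  have t1 : Tm b = (b^2-1)/(2*b) := by unfold Tm; field_simp
  have t2 : Tm c = (c^2-1)/(2*c) := by unfold Tm; field_simp
  rw [t1, t2]
  field_simp

lemma beta_int : ∫ x in Set.Ioo (0:ℝ) 1, x ^ ((1:ℝ)/6 - 1) * (1 - x) ^ ((2:ℝ)/3 - 1) = ProbabilityTheory.beta (1/6) (2/3) := by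
  have hb : 0 < ProbabilityTheory.beta (1/6) (2/3) := ProbabilityTheory.beta_pos (by norm_num) (by norm_num)
  have h := ProbabilityTheory.lintegral_betaPDF_eq_one (α := 1/6) (β := 2/3) (by norm_num) (by norm_num)
  rw [ProbabilityTheory.lintegral_betaPDF] at h
  have h2 : ∫ x in Set.Ioo (0:ℝ) 1, 1 / ProbabilityTheory.beta (1/6) (2/3) * x ^ ((1:ℝ)/6 - 1) * (1 - x) ^ ((2:ℝ)/3 - 1) = 1 := by
    rw [integral_eq_lintegral_of_nonneg_ae, h]
    · simp
    · refine ae_restrict_of_forall_mem measurableSet_Ioo (fun x hx => ?_)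
      have h1 : 0 < x := hx.1
      have h2 : 0 < 1 - x := by linarith [hx.2]
      simp only [Pi.zero_apply]
      positivity
    · exact Measurable.aestronglyMeasurable (by fun_prop)
  simp_rw [mul_assoc] at h2
  rw [integral_const_mul] at h2
  field_simp at h2
  linarith

lemma const_id : (2:ℝ)^((1:ℝ)/3) * hexConst * (1/2 * ProbabilityTheory.beta (1/6) (2/3)) = 1 := by
  unfold hexConst ProbabilityTheory.beta
  have g23 : 0 < Real.Gamma (2/3) := Real.Gamma_pos_of_pos (by norm_num)
  have g56 : 0 < Real.Gamma (5/6) := Real.Gamma_pos_of_pos (by norm_num)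
  have g13 : 0 < Real.Gamma (1/3) := Real.Gamma_pos_of_pos (by norm_num)
  have g16 : 0 < Real.Gamma (1/6) := Real.Gamma_pos_of_pos (by norm_num)
  have hpi := Real.pi_pos
  have s3 : √(3:ℝ)^2 = 3 := Real.sq_sqrt (by norm_num)
  have p3 : 0 < √(3:ℝ) := by positivity
  have r1 := Real.Gamma_mul_Gamma_one_sub (1/6)
  have r2 := Real.Gamma_mul_Gamma_one_sub (1/3)
  have r3 := Real.Gamma_mul_Gamma_add_half (1/3)
  rw [show (1:ℝ) - 1/6 = 5/6 by norm_num, show Real.pi * (1/6) = Real.pi / 6 by ring, Real.sin_pi_div_six] at r1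
  rw [show (1:ℝ) - 1/3 = 2/3 by norm_num, show Real.pi * (1/3) = Real.pi / 3 by ring, Real.sin_pi_div_three] at r2
  rw [show (1:ℝ)/3 + 1/2 = 5/6 by norm_num, show (2:ℝ) * (1/3) = 2/3 by norm_num, show (1:ℝ) - 2/3 = 1/3 by norm_num] at r3
  rw [show (1:ℝ)/6 + 2/3 = 5/6 by norm_num]
  have hpp : Real.pi ^ ((3:ℝ)/2) = Real.pi * √Real.pi := by
    rw [show (3:ℝ)/2 = 1 + 1/2 by norm_num, Real.rpow_add hpi, Real.rpow_one, Real.sqrt_eq_rpow]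
  have hsp : √Real.pi ^ 2 = Real.pi := Real.sq_sqrt hpi.le
  have psp : 0 < √Real.pi := by positivity
  rw [hpp]
  have ht : 0 < (2:ℝ)^((1:ℝ)/3) := by positivity
  generalize (2:ℝ)^((1:ℝ)/3) = t at *
  generalize Real.Gamma (2/3) = A at *
  generalize Real.Gamma (5/6) = B at *
  generalize Real.Gamma (1/3) = D at *
  generalize Real.Gamma (1/6) = E at *
  generalize √(3:ℝ) = s at *
  generalize √Real.pi = w at *
  -- r1 : E B = 2π ; r2 : D A = 2π/s ; r3 : D B = A t w
  field_simp at r1 r2 ⊢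
  rw [← hsp] at r1 r2 ⊢
  have k1 : D * A * s * B = A^2 * t * w * s := by
    calc D * A * s * B = (D * B) * (A * s) := by ring
      _ = _ := by rw [r3]; ring
  have k2 : w^2 * 2 * B = A^2 * t * w * s := by
    rw [← k1]; rw [show D * A * s = w^2*2 by linarith]
  have k3 : w * 2 * B = A^2 * t * s := by
    have : w * (w * 2 * B) = w * (A^2 * t * s) := by linarith
    exact mul_left_cancel₀ psp.ne' this
  have : B * (t * s * A * E * A) = B * (2 * w^2 * w * 2) := by
    calc B * (t * s * A * E * A) = (E * B) * (A^2 * t * s) := by ring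
     _ = _ := by rw [← k3, r1]; ring
  have := mul_left_cancel₀ g56.ne' this
  linarith

lemma fdens_int : ∫ u in Set.Ioi (1:ℝ), fdens u = 1 := by
  have himg : (fun v : ℝ => v ^ (-(1:ℝ)/2)) '' Set.Ioo 0 1 = Set.Ioi 1 := by
    ext u
    constructor
    · rintro ⟨v, hv, rfl⟩
      exact Real.one_lt_rpow_of_pos_of_lt_one_of_neg hv.1 hv.2 (by norm_num)
    · intro hu
      have hu : 1 < u := hu
      have hu0 : 0 < u := by linarith
      refine ⟨u ^ (-(2:ℝ)), ⟨by positivity, Real.rpow_lt_one_of_one_lt_of_neg hu (by norm_num)⟩, ?_⟩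
      simp only
      rw [← Real.rpow_mul hu0.le]; norm_num
  have hder : ∀ v ∈ Set.Ioo (0:ℝ) 1, HasDerivWithinAt (fun v : ℝ => v ^ (-(1:ℝ)/2)) (-(1:ℝ)/2 * v ^ (-(1:ℝ)/2 - 1)) (Set.Ioo 0 1) v := by
    intro v hv
    exact (Real.hasDerivAt_rpow_const (Or.inl hv.1.ne')).hasDerivWithinAt
  have hinj : Set.InjOn (fun v : ℝ => v ^ (-(1:ℝ)/2)) (Set.Ioo 0 1) := by
    intro a ha b hb h
    exact Real.rpow_left_injOn (x := -(1:ℝ)/2) (by norm_num) ha.1.le hb.1.le h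
  rw [← himg, integral_image_eq_integral_abs_deriv_smul measurableSet_Ioo hder hinj]
  refine Eq.trans ?_ const_id
  rw [← beta_int, ← integral_const_mul, ← integral_const_mul]
  refine setIntegral_congr_fun measurableSet_Ioo (fun v hv => ?_)
  have hv0 : 0 < v := hv.1
  have hv1 : 0 < 1 - v := by linarith [hv.2]
  have e1 : |(-(1:ℝ)/2 * v ^ (-(1:ℝ)/2 - 1))| = 1/2 * v ^ (-(3:ℝ)/2) := by
    rw [abs_mul, abs_of_pos (Real.rpow_pos_of_pos hv0 _), show -(1:ℝ)/2 - 1 = -(3:ℝ)/2 by norm_num]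
    congr 1
    rw [abs_of_neg (by norm_num)]; norm_num
  have e2 : (v ^ (-(1:ℝ)/2)) ^ (-(2:ℝ)/3) = v ^ ((1:ℝ)/3) := by
    rw [← Real.rpow_mul hv0.le]; norm_num
  have e3 : ((v ^ (-(1:ℝ)/2))^2 - 1) ^ (-(1:ℝ)/3) = v ^ ((1:ℝ)/3) * (1-v) ^ (-(1:ℝ)/3) := by
    have : (v ^ (-(1:ℝ)/2))^2 - 1 = v⁻¹ * (1 - v) := by
      rw [← Real.rpow_natCast, ← Real.rpow_mul hv0.le]
      norm_num [Real.rpow_neg_one]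
      field_simp
    rw [this, Real.mul_rpow (by positivity) hv1.le, Real.inv_rpow hv0.le, ← Real.rpow_neg hv0.le]
    norm_num
  simp only [smul_eq_mul, fdens]
  rw [e1, e2, e3, show (1:ℝ)/6 - 1 = -(3:ℝ)/2 + (1/3 + 1/3) by norm_num, Real.rpow_add hv0, Real.rpow_add hv0, show (2:ℝ)/3 - 1 = -(1:ℝ)/3 by norm_num]
  ring

lemma vol_octant : (volume.restrict (Set.Ioi (0:ℝ))).prod ((volume.restrict (Set.Ioi (0:ℝ))).prod (volume.restrict (Set.Ioi (0:ℝ))))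
    = (volume : Measure (ℝ × ℝ × ℝ)).restrict octant := by
  rw [Measure.prod_restrict, Measure.prod_restrict]; rfl

lemma octant_meas : MeasurableSet octant := octant_open.measurableSet

lemma map_Phi (F : ℝ × ℝ × ℝ → ENNReal) :
    Measure.map Phi ((volume.restrict octant).withDensity F) =
      (volume.restrict octant).withDensity (fun v =>
        ENNReal.ofReal |(lamV v • ContinuousLinearMap.id ℝ (ℝ × ℝ × ℝ) + (fderiv ℝ lamV v).smulRight v).det| * F (Phi v)) := by
  ext s hs
  have hm : MeasurableSet (s ∩ octant) := hs.inter octant_meas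
  rw [Measure.map_apply Phi_meas hs, withDensity_apply _ (Phi_meas hs), withDensity_apply _ hs,
    Measure.restrict_restrict (Phi_meas hs), Measure.restrict_restrict hs]
  have himg : Phi ⁻¹' s ∩ octant = Phi '' (s ∩ octant) := by
    ext v
    constructor
    · rintro ⟨h1, h2⟩
      exact ⟨Phi v, ⟨h1, Phi_mem h2⟩, Phi_Phi h2⟩
    · rintro ⟨w, ⟨h1, h2⟩, rfl⟩
      refine ⟨?_, Phi_mem h2⟩
      rw [Set.mem_preimage, Phi_Phi h2]; exact h1
  rw [himg]
  have i1 : (volume : Measure (ℝ × ℝ)).IsAddHaarMeasure := by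
    rw [Measure.volume_eq_prod]; infer_instance
  have i2 : (volume : Measure (ℝ × ℝ × ℝ)).IsAddHaarMeasure := by
    rw [Measure.volume_eq_prod]; infer_instance
  exact lintegral_image_eq_lintegral_abs_det_fderiv_mul volume hm
    (fun v hv => (Phi_hasFDerivAt hv.2).hasFDerivWithinAt) (Phi_injOn.mono Set.inter_subset_right) F

/-- inverse coordinate change -/
noncomputable def Em (p : ℝ) : ℝ := p + √(1+p^2)

lemma Em_gt {p : ℝ} (hp : 0 < p) : 1 < Em p := by
  have : 1 ≤ √(1+p^2) := Real.one_le_sqrt.2 (by nlinarith)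
  unfold Em; linarith

lemma Tm_Em {p : ℝ} (hp : 0 < p) : Tm (Em p) = p := by
  have h := Em_gt hp
  have s := sq1 p
  have : Em p * (√(1+p^2) - p) = 1 := by unfold Em; nlinarith
  have hi : (Em p)⁻¹ = √(1+p^2) - p := inv_eq_of_mul_eq_one_right this
  unfold Tm; rw [hi]; unfold Em; ring

lemma Em_Tm {a : ℝ} (ha : 1 < a) : Em (Tm a) = a := by
  unfold Em; rw [Tm_sqrt ha]; unfold Tm; ring

lemma Tm_meas : Measurable Tm := by unfold Tm; fun_prop

lemma Em_cont : Continuous Em := by unfold Em; fun_prop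

lemma Em_deriv (p : ℝ) : HasDerivAt Em (Em p / √(1+p^2)) p := by
  have hs : 0 < √(1+p^2) := by positivity
  have a : HasDerivAt (fun p : ℝ => 1 + p^2) (2 * p) p := by
    refine (((hasDerivAt_id p).pow 2).const_add 1).congr_deriv ?_
    simp
  have b := (hasDerivAt_id p).add (a.sqrt (by positivity))
  refine b.congr_deriv ?_
  unfold Em
  field_simp
  ring

lemma map_Tm (k : ℝ → ENNReal) :
    Measure.map Tm ((volume.restrict (Set.Ioi (1:ℝ))).withDensity k) =
      (volume.restrict (Set.Ioi (0:ℝ))).withDensity (fun p => ENNReal.ofReal (Em p / √(1+p^2)) * k (Em p)) := by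
  ext s hs
  have hm : MeasurableSet (s ∩ Set.Ioi (0:ℝ)) := hs.inter measurableSet_Ioi
  rw [Measure.map_apply Tm_meas hs, withDensity_apply _ (Tm_meas hs), withDensity_apply _ hs,
    Measure.restrict_restrict (Tm_meas hs), Measure.restrict_restrict hs]
  have himg : Tm ⁻¹' s ∩ Set.Ioi 1 = Em '' (s ∩ Set.Ioi 0) := by
    ext v
    constructor
    · rintro ⟨h1, h2⟩
      exact ⟨Tm v, ⟨h1, Tm_pos h2⟩, Em_Tm h2⟩
    · rintro ⟨w, ⟨h1, h2⟩, rfl⟩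
      refine ⟨?_, Em_gt h2⟩
      rw [Set.mem_preimage, Tm_Em h2]; exact h1
  have hinj : Set.InjOn Em (s ∩ Set.Ioi 0) := by
    intro a ha b hb h
    rw [← Tm_Em ha.2, h, Tm_Em hb.2]
  rw [himg, lintegral_image_eq_lintegral_abs_deriv_mul hm (fun v _ => (Em_deriv v).hasDerivWithinAt) hinj]
  refine setLIntegral_congr_fun hm (fun v hv => ?_)
  have := Em_gt hv.2
  rw [abs_of_nonneg (by positivity)]

lemma prod3 (μ : Measure ℝ) [SFinite μ] (k : ℝ → ENNReal) (hk : Measurable k) :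
    (μ.withDensity k).prod ((μ.withDensity k).prod (μ.withDensity k)) =
     (μ.prod (μ.prod μ)).withDensity (fun v => k v.1 * (k v.2.1 * k v.2.2)) := by
  rw [prod_withDensity hk hk, prod_withDensity hk (by fun_prop)]

lemma split_cont (K : ℝ × ℝ × ℝ → ℝ) (hK : ContinuousOn K octant) (hKpos : ∀ v ∈ octant, 0 < K v)
    (h : ℝ → ENNReal)
    (hae : (fun v : ℝ × ℝ × ℝ => h v.1 * (h v.2.1 * h v.2.2)) =ᵐ[volume.restrict octant] fun v => ENNReal.ofReal (K v)) :
    ∃ η : ℝ → ℝ, ContinuousOn η (Set.Ioi 0) ∧ (∀ x, 0 < x → 0 < η x) ∧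
      ∀ x y z, 0 < x → 0 < y → 0 < z → η x * (η y * η z) = K (x, y, z) := by
  rw [← vol_octant] at hae
  set m := (volume : Measure ℝ).restrict (Set.Ioi 0) with hm
  have hm0 : m ≠ 0 := by
    rw [hm, Ne, Measure.restrict_eq_zero]; simp
  have : NeBot (ae m) := ae_neBot.2 hm0
  have hpos : ∀ᵐ x ∂m, 0 < x := ae_restrict_mem measurableSet_Ioi
  obtain ⟨x0, hx, hx0⟩ := ((Measure.ae_ae_of_ae_prod hae).and hpos).exists
  obtain ⟨y0, hy, hy0⟩ := ((Measure.ae_ae_of_ae_prod hx).and hpos).exists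
  simp only at hy
  have hcase : h x0 * h y0 ≠ 0 ∧ h x0 * h y0 ≠ ⊤ := by
    obtain ⟨z1, hz, hz1⟩ := (hy.and hpos).exists
    have hk : 0 < K (x0, y0, z1) := hKpos _ ⟨hx0, hy0, hz1⟩
    rw [← mul_assoc] at hz
    constructor
    · intro h0
      rw [h0, zero_mul, eq_comm, ENNReal.ofReal_eq_zero] at hz
      linarith
    · intro h0
      rw [h0] at hz
      by_cases hh : h z1 = 0
      · rw [hh, mul_zero, eq_comm, ENNReal.ofReal_eq_zero] at hz
        linarith
      · rw [ENNReal.top_mul hh] at hz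
        exact ENNReal.ofReal_ne_top hz.symm
  set κ := h x0 * h y0 with hκ
  have hκp : 0 < κ.toReal := ENNReal.toReal_pos hcase.1 hcase.2
  set η : ℝ → ℝ := fun z => K (x0, y0, z) / κ.toReal with hη
  have hηpos : ∀ x, 0 < x → 0 < η x := fun x hx => div_pos (hKpos _ ⟨hx0, hy0, hx⟩) hκp
  have hηc : ContinuousOn η (Set.Ioi 0) := by
    refine ContinuousOn.div_const ?_ _
    exact hK.comp (f := fun z => (x0, y0, z)) (by fun_prop) (fun z hz => ⟨hx0, hy0, hz⟩)
  have hheq : ∀ᵐ z ∂m, h z = ENNReal.ofReal (η z) := by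
    filter_upwards [hy, hpos] with z hz hz0
    rw [← mul_assoc, ← hκ] at hz
    rw [hη, ENNReal.ofReal_div_of_pos hκp, ENNReal.ofReal_toReal hcase.2, ← hz, mul_comm,
      ENNReal.mul_div_cancel_right hcase.1 hcase.2]
  refine ⟨η, hηc, hηpos, ?_⟩
  have a1 : ∀ᵐ v ∂(m.prod (m.prod m)), h v.1 = ENNReal.ofReal (η v.1) ∧ 0 < v.1 :=
    Measure.quasiMeasurePreserving_fst.ae (hheq.and hpos)
  have a2' : ∀ᵐ v ∂(m.prod m), h v.1 = ENNReal.ofReal (η v.1) ∧ 0 < v.1 :=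
    Measure.quasiMeasurePreserving_fst.ae (hheq.and hpos)
  have a3' : ∀ᵐ v ∂(m.prod m), h v.2 = ENNReal.ofReal (η v.2) ∧ 0 < v.2 :=
    Measure.quasiMeasurePreserving_snd.ae (hheq.and hpos)
  have a23 : ∀ᵐ v ∂(m.prod (m.prod m)), _ := Measure.quasiMeasurePreserving_snd.ae (a2'.and a3')
  have hfin : (fun v : ℝ × ℝ × ℝ => η v.1 * (η v.2.1 * η v.2.2)) =ᵐ[volume.restrict octant] K := by
    rw [← vol_octant, ← hm]
    filter_upwards [hae, a1, a23] with v h1 h2 h3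
    obtain ⟨h2, p1⟩ := h2
    obtain ⟨⟨h3, p2⟩, ⟨h4, p3⟩⟩ := h3
    have q1 := hηpos _ p1
    have q2 := hηpos _ p2
    have q3 := hηpos _ p3
    rw [h2, h3, h4, ← ENNReal.ofReal_mul q2.le, ← ENNReal.ofReal_mul q1.le] at h1
    exact (ENNReal.ofReal_eq_ofReal_iff (by positivity) (hKpos v ⟨p1, p2, p3⟩).le).1 h1
  have := Measure.eqOn_open_of_ae_eq hfin octant_open (by
    refine ContinuousOn.mul ?_ (ContinuousOn.mul ?_ ?_)
    · exact hηc.comp (by fun_prop) (fun v hv => hv.1)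
    · exact hηc.comp (f := fun v : ℝ × ℝ × ℝ => v.2.1) (by fun_prop) (fun v hv => hv.2.1)
    · exact hηc.comp (f := fun v : ℝ × ℝ × ℝ => v.2.2) (by fun_prop) (fun v hv => hv.2.2)) hK
  intro x y z hx hy hz
  exact this (x := (x, y, z)) ⟨hx, hy, hz⟩

noncomputable def wt (p : ℝ) : ℝ := p ^ (-(1:ℝ)/3) / √(1+p^2)

lemma wt_pos {p : ℝ} (hp : 0 < p) : 0 < wt p := by unfold wt; positivity

lemma wt_cont : ContinuousOn wt (Set.Ioi 0) := by
  intro p hp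
  have hp : 0 < p := hp
  apply ContinuousAt.continuousWithinAt
  refine ContinuousAt.div (Real.continuousAt_rpow_const _ _ (Or.inl hp.ne')) (by fun_prop) (by positivity)

lemma wt_Phi {p q r : ℝ} (hp : 0 < p) (hq : 0 < q) (hr : 0 < r) (l : ℝ) (hl : 0 < l) :
    l * ((√(1 + (l*p)^2) * √(1 + (l*q)^2) * √(1 + (l*r)^2)) / (√(1+p^2) * √(1+q^2) * √(1+r^2)))
      * (wt (l*p) * (wt (l*q) * wt (l*r))) = wt p * (wt q * wt r) := by
  unfold wt
  rw [Real.mul_rpow hl.le hp.le, Real.mul_rpow hl.le hq.le, Real.mul_rpow hl.le hr.le]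
  have h : l * (l ^ (-(1:ℝ)/3) * l ^ (-(1:ℝ)/3) * l ^ (-(1:ℝ)/3)) = 1 := by
    rw [← Real.rpow_add hl, ← Real.rpow_add hl]
    norm_num [Real.rpow_neg_one]
    field_simp
  generalize l ^ (-(1:ℝ)/3) = c at *
  generalize p ^ (-(1:ℝ)/3) = P at *
  generalize q ^ (-(1:ℝ)/3) = Q at *
  generalize r ^ (-(1:ℝ)/3) = R at *
  have h1 : 0 < √(1 + (l*p)^2) := by positivity
  have h2 : 0 < √(1 + (l*q)^2) := by positivity
  have h3 : 0 < √(1 + (l*r)^2) := by positivity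
  generalize √(1 + (l*p)^2) = A at *
  generalize √(1 + (l*q)^2) = B at *
  generalize √(1 + (l*r)^2) = D at *
  field_simp
  linear_combination (P * Q * R) * h

theorem meas_fe (G : ℝ → ℝ) (hG : ContinuousOn G (Set.Ioi 0)) (hGpos : ∀ p, 0 < p → 0 < G p)
    (gt ht : ℝ → ENNReal) (hgm : Measurable gt) (hhm : Measurable ht)
    (hgt : ∀ p, 0 < p → gt p = ENNReal.ofReal (G p * wt p))
    (hmap : Measure.map Phi (((volume.restrict (Set.Ioi (0:ℝ))).withDensity gt).prod
        (((volume.restrict (Set.Ioi (0:ℝ))).withDensity gt).prod ((volume.restrict (Set.Ioi (0:ℝ))).withDensity gt)))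
      = ((volume.restrict (Set.Ioi (0:ℝ))).withDensity ht).prod
        (((volume.restrict (Set.Ioi (0:ℝ))).withDensity ht).prod ((volume.restrict (Set.Ioi (0:ℝ))).withDensity ht))) :
    ∃ η : ℝ → ℝ, ContinuousOn η (Set.Ioi 0) ∧ (∀ x, 0 < x → 0 < η x) ∧
      ∀ p q r, 0 < p → 0 < q → 0 < r →
        η p * (η q * η r) = G (lam p q r * p) * (G (lam p q r * q) * G (lam p q r * r)) := by
  rw [prod3 _ _ hgm, prod3 _ _ hhm, vol_octant, map_Phi] at hmap
  have key : ∀ v ∈ octant, ENNReal.ofReal |(lamV v • ContinuousLinearMap.id ℝ (ℝ × ℝ × ℝ) + (fderiv ℝ lamV v).smulRight v).det|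
      * (gt (Phi v).1 * (gt (Phi v).2.1 * gt (Phi v).2.2)) =
      ENNReal.ofReal ((G (Phi v).1 * (G (Phi v).2.1 * G (Phi v).2.2)) * (wt v.1 * (wt v.2.1 * wt v.2.2))) := by
    intro v hv
    have hl := lamV_pos hv
    have hP := Phi_mem hv
    have p1 : 0 < (Phi v).1 := hP.1
    have p2 : 0 < (Phi v).2.1 := hP.2.1
    have p3 : 0 < (Phi v).2.2 := hP.2.2
    have w1 := wt_pos p1
    have w2 := wt_pos p2
    have w3 := wt_pos p3
    have g1 := hGpos _ p1
    have g2 := hGpos _ p2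
    have g3 := hGpos _ p3
    rw [hgt _ p1, hgt _ p2, hgt _ p3, Phi_det hv, ← ENNReal.ofReal_mul (by positivity),
      ← ENNReal.ofReal_mul (by positivity), ← ENNReal.ofReal_mul (by positivity)]
    congr 1
    rw [← wt_Phi hv.1 hv.2.1 hv.2.2 (lamV v) hl]
    have e1 : (Phi v).1 = lamV v * v.1 := rfl
    have e2 : (Phi v).2.1 = lamV v * v.2.1 := rfl
    have e3 : (Phi v).2.2 = lamV v * v.2.2 := rfl
    rw [e1, e2, e3]
    ring
  have hKc : ContinuousOn (fun v => (G (Phi v).1 * (G (Phi v).2.1 * G (Phi v).2.2)) * (wt v.1 * (wt v.2.1 * wt v.2.2))) octant := by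
    have c1 : ContinuousOn (fun v => (Phi v).1) octant := continuous_fst.comp_continuousOn Phi_cont
    have c2 : ContinuousOn (fun v => (Phi v).2.1) octant := (continuous_fst.comp continuous_snd).comp_continuousOn Phi_cont
    have c3 : ContinuousOn (fun v => (Phi v).2.2) octant := (continuous_snd.comp continuous_snd).comp_continuousOn Phi_cont
    refine ContinuousOn.mul (ContinuousOn.mul ?_ (ContinuousOn.mul ?_ ?_)) (ContinuousOn.mul ?_ (ContinuousOn.mul ?_ ?_))
    · exact hG.comp c1 (fun v hv => (Phi_mem hv).1)
    · exact hG.comp c2 (fun v hv => (Phi_mem hv).2.1)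
    · exact hG.comp c3 (fun v hv => (Phi_mem hv).2.2)
    · exact wt_cont.comp (f := fun v : ℝ × ℝ × ℝ => v.1) (by fun_prop) (fun v hv => hv.1)
    · exact wt_cont.comp (f := fun v : ℝ × ℝ × ℝ => v.2.1) (by fun_prop) (fun v hv => hv.2.1)
    · exact wt_cont.comp (f := fun v : ℝ × ℝ × ℝ => v.2.2) (by fun_prop) (fun v hv => hv.2.2)
  have hKpos : ∀ v ∈ octant, 0 < (G (Phi v).1 * (G (Phi v).2.1 * G (Phi v).2.2)) * (wt v.1 * (wt v.2.1 * wt v.2.2)) := by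
    intro v hv
    have hP := Phi_mem hv
    have g1 := hGpos _ hP.1
    have g2 := hGpos _ hP.2.1
    have g3 := hGpos _ hP.2.2
    have w1 := wt_pos hv.1
    have w2 := wt_pos hv.2.1
    have w3 := wt_pos hv.2.2
    positivity
  have hKae : (fun v => ENNReal.ofReal |(lamV v • ContinuousLinearMap.id ℝ (ℝ × ℝ × ℝ) + (fderiv ℝ lamV v).smulRight v).det|
      * (gt (Phi v).1 * (gt (Phi v).2.1 * gt (Phi v).2.2))) =ᵐ[volume.restrict octant]
      fun v => ENNReal.ofReal ((G (Phi v).1 * (G (Phi v).2.1 * G (Phi v).2.2)) * (wt v.1 * (wt v.2.1 * wt v.2.2))) :=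
    ae_restrict_of_forall_mem octant_meas key
  rw [withDensity_congr_ae hKae] at hmap
  rw [withDensity_eq_iff_of_sigmaFinite (hKc.aemeasurable octant_meas).ennreal_ofReal (by fun_prop)] at hmap
  obtain ⟨η, hηc, hηp, hη⟩ := split_cont _ hKc hKpos ht hmap.symm
  refine ⟨fun x => η x / wt x, hηc.div wt_cont (fun x hx => (wt_pos hx).ne'), fun x hx => div_pos (hηp x hx) (wt_pos hx), ?_⟩
  intro p q r hp hq hr
  have h := hη p q r hp hq hr
  have w1 := wt_pos hp
  have w2 := wt_pos hq
  have w3 := wt_pos hr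
  have e : η p / wt p * (η q / wt q * (η r / wt r)) = (η p * (η q * η r)) / (wt p * (wt q * wt r)) := by
    field_simp
  simp only [e, h]
  rw [mul_div_assoc, div_self (by positivity), mul_one]
  rfl

lemma T3_Psi {a b c : ℝ} (ha : 1 < a) (hb : 1 < b) (hc : 1 < c) :
    Prod.map Tm (Prod.map Tm Tm) (Psi (a, b, c)) = Phi (Prod.map Tm (Prod.map Tm Tm) (a, b, c)) := by
  have h1 := Tm_hexA ha hb hc
  have h2 := Tm_hexA hb ha hc
  have h3 := Tm_hexA hc ha hb
  rw [← lam_swap12] at h2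
  rw [← lam_rot] at h3
  have e1 : Phi (Prod.map Tm (Prod.map Tm Tm) (a, b, c)) =
    (lam (Tm a) (Tm b) (Tm c) * Tm a, lam (Tm a) (Tm b) (Tm c) * Tm b, lam (Tm a) (Tm b) (Tm c) * Tm c) := rfl
  rw [e1, ← h1, ← h2, ← h3]
  rfl

lemma Psi_meas : Measurable Psi := by
  unfold Psi hexA ratioA
  fun_prop

lemma T3_meas : Measurable (Prod.map Tm (Prod.map Tm Tm)) :=
  Tm_meas.prodMap (Tm_meas.prodMap Tm_meas)

lemma map_T3 (μ : Measure ℝ) [SFinite μ] :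
    Measure.map (Prod.map Tm (Prod.map Tm Tm)) (μ.prod (μ.prod μ)) =
      (μ.map Tm).prod ((μ.map Tm).prod (μ.map Tm)) := by
  rw [Measure.map_prod_map _ _ Tm_meas Tm_meas, Measure.map_prod_map _ _ Tm_meas (Tm_meas.prodMap Tm_meas)]

lemma map_transfer (k l : ℝ → ENNReal) 
    (hmap : Measure.map Psi (((volume.restrict (Set.Ioi (1:ℝ))).withDensity k).prod
        (((volume.restrict (Set.Ioi (1:ℝ))).withDensity k).prod ((volume.restrict (Set.Ioi (1:ℝ))).withDensity k)))
      = ((volume.restrict (Set.Ioi (1:ℝ))).withDensity l).prod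
        (((volume.restrict (Set.Ioi (1:ℝ))).withDensity l).prod ((volume.restrict (Set.Ioi (1:ℝ))).withDensity l))) :
    Measure.map Phi ((((volume.restrict (Set.Ioi (1:ℝ))).withDensity k).map Tm).prod
        ((((volume.restrict (Set.Ioi (1:ℝ))).withDensity k).map Tm).prod (((volume.restrict (Set.Ioi (1:ℝ))).withDensity k).map Tm)))
      = (((volume.restrict (Set.Ioi (1:ℝ))).withDensity l).map Tm).prod
        ((((volume.restrict (Set.Ioi (1:ℝ))).withDensity l).map Tm).prod (((volume.restrict (Set.Ioi (1:ℝ))).withDensity l).map Tm)) := by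
  rw [← map_T3, ← map_T3, ← hmap, Measure.map_map Phi_meas T3_meas, Measure.map_map T3_meas Psi_meas]
  set μ := (volume.restrict (Set.Ioi (1:ℝ))).withDensity k with hμ
  have hpos : ∀ᵐ x ∂μ, 1 < x :=
    (withDensity_absolutelyContinuous _ _).ae_le (ae_restrict_mem measurableSet_Ioi)
  have a1 : ∀ᵐ v ∂(μ.prod (μ.prod μ)), 1 < v.1 := Measure.quasiMeasurePreserving_fst.ae hpos
  have a2' : ∀ᵐ v ∂(μ.prod μ), 1 < v.1 := Measure.quasiMeasurePreserving_fst.ae hpos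
  have a3' : ∀ᵐ v ∂(μ.prod μ), 1 < v.2 := Measure.quasiMeasurePreserving_snd.ae hpos
  have a23 : ∀ᵐ v ∂(μ.prod (μ.prod μ)), 1 < v.2.1 ∧ 1 < v.2.2 :=
    Measure.quasiMeasurePreserving_snd.ae (a2'.and a3')
  refine Measure.map_congr ?_
  filter_upwards [a1, a23] with v h1 h2
  exact (T3_Psi h1 h2.1 h2.2).symm

lemma fdens_Tm {u : ℝ} (hu : 1 < u) : u * fdens u * (Tm u) ^ ((1:ℝ)/3) = hexConst := by
  have hu0 : 0 < u := by linarith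
  have hq : 0 < u^2 - 1 := by nlinarith
  have e : Tm u = (u^2 - 1) * (u⁻¹ * (2:ℝ)⁻¹) := by unfold Tm; field_simp
  rw [e, Real.mul_rpow hq.le (by positivity), Real.mul_rpow (by positivity) (by positivity),
    Real.inv_rpow hu0.le, Real.inv_rpow (by norm_num)]
  unfold fdens
  have h1 : u * (u ^ (-(2:ℝ)/3) * (u ^ ((1:ℝ)/3))⁻¹) = 1 := by
    rw [← Real.rpow_neg hu0.le, ← Real.rpow_add hu0]
    norm_num [Real.rpow_neg_one]
    field_simp
  have h2 : (u^2 - 1) ^ (-(1:ℝ)/3) * (u^2 - 1) ^ ((1:ℝ)/3) = 1 := by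
    rw [← Real.rpow_add hq]; norm_num
  have h3 : (2:ℝ) ^ ((1:ℝ)/3) * ((2:ℝ) ^ ((1:ℝ)/3))⁻¹ = 1 := mul_inv_cancel₀ (by positivity)
  calc _ = hexConst * (u * (u ^ (-(2:ℝ)/3) * (u ^ ((1:ℝ)/3))⁻¹))
      * ((u^2 - 1) ^ (-(1:ℝ)/3) * (u^2 - 1) ^ ((1:ℝ)/3))
      * ((2:ℝ) ^ ((1:ℝ)/3) * ((2:ℝ) ^ ((1:ℝ)/3))⁻¹) := by ring
    _ = _ := by rw [h1, h2, h3]; ring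

lemma hexConst_pos : 0 < hexConst := by
  have g23 : 0 < Real.Gamma (2/3) := Real.Gamma_pos_of_pos (by norm_num)
  have g56 : 0 < Real.Gamma (5/6) := Real.Gamma_pos_of_pos (by norm_num)
  have := Real.pi_pos
  unfold hexConst; positivity

end Helpers

/-- `f` is the unique independence-preserving density for `Ψ`: if `g` is a
continuous, strictly positive probability density on `(1,∞)` such that the pushforward
of `(g da)⊗(g db)⊗(g dc)` under `Ψ` is again a product measure `(h dA)⊗(h dB)⊗(h dC)`
for some `h`, then `g = f` on `(1,∞)`. -/
theorem stmt9 (g : ℝ → ℝ)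
    (hgcont : ContinuousOn g (Set.Ioi 1))
    (hgpos : ∀ u ∈ Set.Ioi (1:ℝ), 0 < g u)
    (hgprob : (∫ u in Set.Ioi (1:ℝ), g u) = 1)
    (hprod : ∃ h : ℝ → ℝ,
      Measure.map Psi ((densMeasure g).prod ((densMeasure g).prod (densMeasure g))) =
        (densMeasure h).prod ((densMeasure h).prod (densMeasure h))) :
    ∀ u : ℝ, 1 < u → g u = fdens u := by
  obtain ⟨h, hprod⟩ := hprod
  obtain ⟨l, hlm, -, hl⟩ := exists_measurable_le_withDensity_eq (volume.restrict (Set.Ioi (1:ℝ)))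
    (fun u => ENNReal.ofReal (h u))
  set k : ℝ → ENNReal := fun u => ENNReal.ofReal ((Set.Ioi (1:ℝ)).indicator g u) with hk
  have hkm : Measurable k := by
    refine Measurable.ennreal_ofReal ?_
    have : Measurable ((Set.Ioi (1:ℝ)).piecewise g 0) :=
      hgcont.measurable_piecewise continuousOn_const measurableSet_Ioi
    rwa [Set.piecewise_eq_indicator] at this
  have hkg : densMeasure g = (volume.restrict (Set.Ioi (1:ℝ))).withDensity k := by
    unfold densMeasure
    refine withDensity_congr_ae (ae_restrict_of_forall_mem measurableSet_Ioi fun u hu => ?_)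
    simp only [hk, Set.indicator_of_mem hu]
  have hlh : densMeasure h = (volume.restrict (Set.Ioi (1:ℝ))).withDensity l := hl.symm
  rw [hkg, hlh] at hprod
  have hmap := map_transfer k l hprod
  rw [map_Tm, map_Tm] at hmap
  set G : ℝ → ℝ := fun p => Em p * g (Em p) * p ^ ((1:ℝ)/3) with hG
  have hGc : ContinuousOn G (Set.Ioi 0) := by
    refine ContinuousOn.mul (ContinuousOn.mul Em_cont.continuousOn ?_) ?_
    · exact hgcont.comp Em_cont.continuousOn (fun p hp => Em_gt hp)
    · exact (Real.continuous_rpow_const (by norm_num)).continuousOn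
  have hGpos : ∀ p, 0 < p → 0 < G p := by
    intro p hp
    have h1 := Em_gt hp
    have h2 := hgpos _ h1
    have h3 : 0 < Em p := by linarith
    simp only [hG]
    positivity
  have hEm : Measurable Em := Em_cont.measurable
  obtain ⟨η, hηc, hηp, hη⟩ := meas_fe G hGc hGpos _ _
    ((by fun_prop : Measurable fun p : ℝ => ENNReal.ofReal (Em p / √(1+p^2))).mul (hkm.comp hEm))
    ((by fun_prop : Measurable fun p : ℝ => ENNReal.ofReal (Em p / √(1+p^2))).mul (hlm.comp hEm))
    (by
      intro p hp
      have h1 := Em_gt hp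
      have h3 : 0 < Em p := by linarith
      have h4 : (p ^ ((1:ℝ)/3)) * p ^ (-(1:ℝ)/3) = 1 := by
        rw [← Real.rpow_add hp]; norm_num
      have h5 : k (Em p) = ENNReal.ofReal (g (Em p)) := by
        simp only [hk]
        rw [Set.indicator_of_mem (show Em p ∈ Set.Ioi (1:ℝ) from h1)]
      change ENNReal.ofReal (Em p / √(1+p^2)) * k (Em p) = _
      rw [h5, ← ENNReal.ofReal_mul (by positivity)]
      congr 1
      simp only [hG, wt]
      linear_combination (-(Em p * g (Em p) / √(1+p^2))) * h4) hmap
  obtain ⟨d, hd⟩ := fe_main (g := fun p => Real.log (η p)) (η := fun p => Real.log (G p))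
    (hηc.log fun x hx => (hηp x hx).ne') (hGc.log fun x hx => (hGpos x hx).ne') (by
      intro p q r hp hq hr
      have hl := lam_pos hp hq hr
      have e := hη p q r hp hq hr
      have g1 := hGpos _ (mul_pos hl hp)
      have g2 := hGpos _ (mul_pos hl hq)
      have g3 := hGpos _ (mul_pos hl hr)
      have n1 := hηp _ hp
      have n2 := hηp _ hq
      have n3 := hηp _ hr
      have e2 := congrArg Real.log e
      rw [Real.log_mul n1.ne' (by positivity), Real.log_mul n2.ne' n3.ne',
        Real.log_mul g1.ne' (by positivity), Real.log_mul g2.ne' g3.ne'] at e2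
      linarith)
  have hC := hexConst_pos
  have hgf : ∀ u : ℝ, 1 < u → g u = (Real.exp d / hexConst) * fdens u := by
    intro u hu
    have hT := Tm_pos hu
    have h1 : G (Tm u) = Real.exp d := by
      rw [← hd _ hT, Real.exp_log (hGpos _ hT)]
    simp only [hG] at h1
    rw [Em_Tm hu] at h1
    have h2 := fdens_Tm hu
    have hP : 0 < Tm u ^ ((1:ℝ)/3) := by positivity
    have hu0 : 0 < u := by linarith
    have hne : u * Tm u ^ ((1:ℝ)/3) ≠ 0 := by positivity
    refine mul_right_cancel₀ hne ?_
    rw [div_mul_eq_mul_div, div_mul_eq_mul_div, eq_div_iff hC.ne']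
    rw [← h1, ← h2]
    ring
  have hone : Real.exp d / hexConst = 1 := by
    have : ∫ u in Set.Ioi (1:ℝ), g u = ∫ u in Set.Ioi (1:ℝ), (Real.exp d / hexConst) * fdens u :=
      setIntegral_congr_fun measurableSet_Ioi fun u hu => hgf u hu
    rw [integral_const_mul, fdens_int, hgprob, mul_one] at this
    exact this.symm
  intro u hu
  rw [hgf u hu, hone, one_mul]
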